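/- Let y be a real number with 1 < y < √3 and define v₀(y) := max{V₃, 2C₃/|y²−3| + 1} with the constants C₁, C₂, C₃, V₁, V₂, V₃ as specified. Then the infimum over integers v ≥ 3 of 1 − J_v(y) = 2 − 2·F_v(y·√(v/(v−2))) equals the minimum of 2 − 2·F_v(y·√(v/(v−2))) over the finitely many integers v with 3 ≤ v ≤ ⌊v₀(y)⌋ + 3. -/

import Mathlib

open MeasureTheory Real

/-- The Student t density with `v` degrees of freedom. -/
noncomputable def tDensity (v x : ℝ) : ℝ :=
  Real.Gamma ((v + 1) / 2) / (Real.sqrt (v * π) * Real.Gamma (v / 2)) *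
    (1 + x ^ 2 / v) ^ (-((v + 1) / 2))

/-- The Student t distribution function. -/
noncomputable def tCDF (v t : ℝ) : ℝ := ∫ x in Set.Iic t, tDensity v x

/-- The normalising constant of the Student t density after rescaling by `√v`. -/
noncomputable def tConst (v : ℝ) : ℝ :=
  Real.Gamma ((v + 1) / 2) / (Real.sqrt π * Real.Gamma (v / 2))

lemma tConst_nonneg {v : ℝ} (hv : 0 < v) : 0 ≤ tConst v := by
  have := Real.Gamma_pos_of_pos (show 0 < (v + 1) / 2 by positivity)
  have := Real.Gamma_pos_of_pos (show 0 < v / 2 by positivity)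
  unfold tConst
  positivity

lemma tConst_add_two {v : ℝ} (hv : 0 < v) : tConst (v + 2) = (v + 1) / v * tConst v := by
  have h1 := (Real.Gamma_pos_of_pos (show 0 < v / 2 by positivity)).ne'
  have h2 : Real.Gamma ((v + 2 + 1) / 2) = (v + 1) / 2 * Real.Gamma ((v + 1) / 2) := by
    rw [← Real.Gamma_add_one (by positivity)]; ring_nf
  have h3 : Real.Gamma ((v + 2) / 2) = v / 2 * Real.Gamma (v / 2) := by
    rw [← Real.Gamma_add_one (by positivity)]; ring_nf
  unfold tConst
  rw [h2, h3]
  field_simp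

open scoped Pointwise in
lemma tCDF_eq_tConst_mul {v : ℝ} (hv : 0 < v) (t : ℝ) :
    tCDF v t = tConst v * ∫ r in Set.Iic (t / √v), (1 + r ^ 2) ^ (-((v + 1) / 2)) := by
  have hs : 0 < √v := Real.sqrt_pos.2 hv
  have h := Measure.setIntegral_comp_smul_of_pos (μ := (volume : Measure ℝ))
    (fun x : ℝ => (1 + x ^ 2) ^ (-((v + 1) / 2))) (Set.Iic t) (inv_pos.2 hs)
  have himg : (√v)⁻¹ • Set.Iic t = Set.Iic (t / √v) := by
    ext x
    rw [Set.mem_smul_set_iff_inv_smul_mem₀ (inv_pos.2 hs).ne', inv_inv, smul_eq_mul,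
      Set.mem_Iic, Set.mem_Iic, le_div_iff₀ hs, mul_comm]
  rw [himg] at h
  simp only [smul_eq_mul, Module.finrank_self, pow_one, inv_inv] at h
  have hd : ∀ x, tDensity v x =
      tConst v / √v * (1 + ((√v)⁻¹ * x) ^ 2) ^ (-((v + 1) / 2)) := by
    intro x
    have : ((√v)⁻¹ * x) ^ 2 = x ^ 2 / v := by
      rw [mul_pow, inv_pow, Real.sq_sqrt hv.le]; ring
    rw [this, tDensity, tConst, Real.sqrt_mul hv.le]
    congr 1
    field_simp
  simp only [tCDF, hd]
  rw [integral_const_mul, h]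
  field_simp

lemma integrable_one_add_sq_rpow {a : ℝ} (ha : 1 / 2 < a) :
    Integrable fun r : ℝ => (1 + r ^ 2) ^ (-a) := by
  have h := integrable_rpow_neg_one_add_norm_sq (E := ℝ) (μ := volume) (r := 2 * a)
    (by simp; linarith)
  refine h.congr (Filter.Eventually.of_forall fun r => ?_)
  simp only [Real.norm_eq_abs, sq_abs]
  congr 1
  ring

lemma hasDerivAt_mul_one_add_sq_rpow (a r : ℝ) :
    HasDerivAt (fun r : ℝ => r * (1 + r ^ 2) ^ (-a))
      (2 * a * (1 + r ^ 2) ^ (-(a + 1)) - (2 * a - 1) * (1 + r ^ 2) ^ (-a)) r := by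
  have hp : 0 < 1 + r ^ 2 := by positivity
  have h0 : HasDerivAt (fun r : ℝ => 1 + r ^ 2) (2 * r) r := by
    simpa using (hasDerivAt_pow 2 r).const_add 1
  have h := (hasDerivAt_id r).mul (h0.rpow_const (p := -a) (Or.inl hp.ne'))
  have e : (1 + r ^ 2) ^ (-a) = (1 + r ^ 2) ^ (-(a + 1)) * (1 + r ^ 2) := by
    rw [← Real.rpow_add_one hp.ne']; ring_nf
  have e' : (-a - 1) = -(a + 1) := by ring
  refine h.congr_deriv ?_
  rw [e', e]
  simp only [id]
  ring

lemma tendsto_mul_one_add_sq_rpow_atBot {a : ℝ} (ha : 1 / 2 < a) :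
    Filter.Tendsto (fun r : ℝ => r * (1 + r ^ 2) ^ (-a)) Filter.atBot (nhds 0) := by
  have h1 : Filter.Tendsto (fun r : ℝ => 1 + r ^ 2) Filter.atBot Filter.atTop :=
    Filter.tendsto_atTop_add_const_left _ _
      (by simpa [Function.comp_def] using
        (Filter.tendsto_pow_atTop (α := ℝ) two_ne_zero).comp Filter.tendsto_abs_atBot_atTop)
  have h2 := (tendsto_rpow_neg_atTop (show 0 < a - 1 / 2 by linarith)).comp h1
  refine squeeze_zero_norm (fun r => ?_) h2
  have hp : 0 < 1 + r ^ 2 := by positivity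
  have e : (1 + r ^ 2) ^ (-(a - 1 / 2)) = √(1 + r ^ 2) * (1 + r ^ 2) ^ (-a) := by
    rw [Real.sqrt_eq_rpow, ← Real.rpow_add hp]; ring_nf
  simp only [Function.comp, e, norm_mul, Real.norm_eq_abs]
  rw [abs_of_pos (Real.rpow_pos_of_pos hp _)]
  gcongr
  exact Real.abs_le_sqrt (by linarith)

lemma integral_Iic_one_add_sq_rpow_add_one {a : ℝ} (ha : 1 / 2 < a) (b : ℝ) :
    2 * a * ∫ r in Set.Iic b, (1 + r ^ 2) ^ (-(a + 1)) =
      (2 * a - 1) * (∫ r in Set.Iic b, (1 + r ^ 2) ^ (-a)) + b * (1 + b ^ 2) ^ (-a) := by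
  have i1 := ((integrable_one_add_sq_rpow (a := a + 1) (by linarith)).const_mul
    (2 * a)).integrableOn (s := Set.Iic b)
  have i2 := ((integrable_one_add_sq_rpow ha).const_mul (2 * a - 1)).integrableOn
    (s := Set.Iic b)
  have h := integral_Iic_of_hasDerivAt_of_tendsto'
    (fun r _ => hasDerivAt_mul_one_add_sq_rpow a r) (i1.sub i2)
    (tendsto_mul_one_add_sq_rpow_atBot ha)
  rw [integral_sub i1 i2, integral_const_mul, integral_const_mul] at h
  linarith

/-- Raising the degrees of freedom by two changes the rescaled distribution function by an
elementary term. -/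
lemma tCDF_add_two {v : ℝ} (hv : 0 < v) (t : ℝ) :
    tCDF (v + 2) t = tConst v * ((∫ r in Set.Iic (t / √(v + 2)), (1 + r ^ 2) ^ (-((v + 1) / 2)))
      + t / √(v + 2) * (1 + (t / √(v + 2)) ^ 2) ^ (-((v + 1) / 2)) / v) := by
  have h := integral_Iic_one_add_sq_rpow_add_one (a := (v + 1) / 2) (by linarith)
    (t / √(v + 2))
  have e : (v + 2 + 1) / 2 = (v + 1) / 2 + 1 := by ring
  rw [tCDF_eq_tConst_mul (by linarith), tConst_add_two hv, e]
  field_simp at h ⊢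
  linear_combination tConst v * h

lemma one_sub_mul_le_one_add_rpow_neg {a w : ℝ} (ha : 0 ≤ a) (hw : -1 < w) :
    1 - a * w ≤ (1 + w) ^ (-a) := by
  rw [Real.rpow_def_of_pos (by linarith)]
  have h1 := Real.log_le_sub_one_of_pos (show 0 < 1 + w by linarith)
  have h2 := Real.add_one_le_exp (log (1 + w) * -a)
  nlinarith

lemma one_add_sq_rpow_neg_ge {a b r : ℝ} (ha : 0 ≤ a) (hb : 0 ≤ b) (hr : b ≤ r) :
    (1 + b ^ 2) ^ (-a) * (1 - a * (r ^ 2 - b ^ 2)) ≤ (1 + r ^ 2) ^ (-a) := by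
  have hp : 0 < 1 + b ^ 2 := by positivity
  have hd : 0 ≤ r ^ 2 - b ^ 2 := by nlinarith
  have hw : 0 ≤ (r ^ 2 - b ^ 2) / (1 + b ^ 2) := by positivity
  have e : 1 + r ^ 2 = (1 + b ^ 2) * (1 + (r ^ 2 - b ^ 2) / (1 + b ^ 2)) := by
    field_simp; ring
  rw [e, Real.mul_rpow hp.le (by linarith)]
  gcongr
  refine le_trans ?_ (one_sub_mul_le_one_add_rpow_neg ha (by linarith))
  have : (r ^ 2 - b ^ 2) / (1 + b ^ 2) ≤ r ^ 2 - b ^ 2 :=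
    div_le_self hd (by nlinarith)
  gcongr

lemma intervalIntegral_one_add_sq_rpow_ge {a b c : ℝ} (ha : 0 ≤ a) (hb : 0 ≤ b) (hc : b ≤ c) :
    (1 + b ^ 2) ^ (-a) * ((c - b) - a * ((c - b) ^ 2 * b + (c - b) ^ 3 / 3)) ≤
      ∫ r in b..c, (1 + r ^ 2) ^ (-a) := by
  have hcont : Continuous fun r : ℝ => (1 + r ^ 2) ^ (-a) := by
    refine Continuous.rpow_const (by fun_prop) fun r => Or.inl ?_
    positivity
  have hp : Continuous fun r : ℝ => (1 + b ^ 2) ^ (-a) * (1 - a * (r ^ 2 - b ^ 2)) := by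
    fun_prop
  have h := intervalIntegral.integral_mono_on (μ := volume) hc (hp.intervalIntegrable b c)
    (hcont.intervalIntegrable b c) fun r hr => one_add_sq_rpow_neg_ge ha hb hr.1
  refine le_trans (le_of_eq ?_) h
  have hi : ∫ r in b..c, (1 - a * (r ^ 2 - b ^ 2)) =
      (c - b) - a * ((c ^ 3 - b ^ 3) / 3 - (c - b) * b ^ 2) := by
    have i1 : Continuous fun r : ℝ => a * (r ^ 2 - b ^ 2) := by fun_prop
    rw [intervalIntegral.integral_sub (by simp) (i1.intervalIntegrable b c),
      intervalIntegral.integral_const_mul,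
      intervalIntegral.integral_sub ((continuous_pow 2).intervalIntegrable b c) (by simp),
      integral_pow]
    simp
    norm_num
  rw [intervalIntegral.integral_const_mul, hi]
  ring

lemma inv_le_standardization_gap {v y e : ℝ} (hv : 100 ≤ v) (hyv : 18 ≤ v * (3 - y ^ 2))
    (he : 0 ≤ e) (hev : (1 + e) ^ 2 * (v - 2) = v) :
    1 / v ≤ e - (v + 1) / 2 * (y ^ 2 / v) * (e ^ 2 + e ^ 3 / 3) := by
  have hv0 : 0 < v := by linarith
  have he1 : e ≤ 1 / 98 := by
    nlinarith [mul_nonneg he (sub_nonneg.2 hv), mul_nonneg (sq_nonneg e) (sub_nonneg.2 hv)]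
  obtain ⟨q, hq⟩ : ∃ q, q = 1 / v := ⟨_, rfl⟩
  have hvq : v * q = 1 := by rw [hq]; field_simp
  have hqe : 2 * (1 + e) ^ 2 * q = e * (2 + e) := by
    linear_combination ((1 + e) ^ 2 - 1) * hvq - q * hev
  have hq_lower : 9 / 10 * e ≤ q := by
    have h : 9 / 10 * e * (2 * (1 + e) ^ 2) ≤ q * (2 * (1 + e) ^ 2) := by
      have : 9 / 10 * (2 * (1 + e) ^ 2) ≤ 2 + e := by nlinarith
      nlinarith [mul_le_mul_of_nonneg_left this he]
    exact le_of_mul_le_mul_right h (by positivity)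
  have hq_upper : q ≤ e - (3 / 2 - 5 / 2 * e) * e ^ 2 := by
    have h : 0 ≤ e ^ 3 * (4 + e * (7 + 5 * e)) := by positivity
    refine le_of_mul_le_mul_right (a := 2 * (1 + e) ^ 2) ?_ (by positivity)
    nlinarith
  have hqe' : q ≤ e := by nlinarith [sq_nonneg e]
  have hy : y ^ 2 ≤ 3 - 16 * e := by
    have : q * 18 ≤ q * (v * (3 - y ^ 2)) := by gcongr; nlinarith
    nlinarith
  have hprod : (1 + q) / 2 * y ^ 2 * (1 + e / 3) ≤ 3 / 2 - 5 / 2 * e := by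
    calc (1 + q) / 2 * y ^ 2 * (1 + e / 3) ≤ (1 + e) / 2 * (3 - 16 * e) * (1 + e / 3) := by
          gcongr
      _ ≤ _ := by nlinarith [mul_nonneg he he, pow_nonneg he 3]
  have e1 : (v + 1) / 2 * (y ^ 2 / v) * (e ^ 2 + e ^ 3 / 3) =
      (1 + q) / 2 * y ^ 2 * (1 + e / 3) * e ^ 2 := by
    rw [hq]; field_simp
  rw [e1, ← hq]
  nlinarith [mul_le_mul_of_nonneg_right hprod (sq_nonneg e)]

/-- The comparison of the standardised distribution functions at `v` and `v + 2`. -/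
lemma tCDF_standardized_add_two_le {v y : ℝ} (hv : 100 ≤ v) (hy : 0 ≤ y)
    (hyv : 18 ≤ v * (3 - y ^ 2)) :
    tCDF (v + 2) (y * √((v + 2) / v)) ≤ tCDF v (y * √(v / (v - 2))) := by
  have hv0 : 0 < v := by linarith
  have hv2 : 0 < v - 2 := by linarith
  have hs : 0 < √v := Real.sqrt_pos.2 hv0
  have hs2 : 0 < √(v - 2) := Real.sqrt_pos.2 hv2
  have hs3 : 0 < √(v + 2) := Real.sqrt_pos.2 (by linarith)
  have e1 : y * √((v + 2) / v) / √(v + 2) = y / √v := by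
    rw [Real.sqrt_div (by linarith)]; field_simp
  have e2 : y * √(v / (v - 2)) / √v = y / √(v - 2) := by
    rw [Real.sqrt_div hv0.le]; field_simp
  rw [tCDF_add_two hv0, tCDF_eq_tConst_mul hv0, e1, e2]
  refine mul_le_mul_of_nonneg_left ?_ (tConst_nonneg hv0)
  have hle : √(v - 2) ≤ √v := Real.sqrt_le_sqrt (by linarith)
  have hbc : y / √v ≤ y / √(v - 2) := by gcongr
  have hint := integrable_one_add_sq_rpow (a := (v + 1) / 2) (by linarith)
  have hsplit := intervalIntegral.integral_Iic_sub_Iic (hint.integrableOn (s := Set.Iic (y / √v)))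
    (hint.integrableOn (s := Set.Iic (y / √(v - 2))))
  have hlow := intervalIntegral_one_add_sq_rpow_ge (a := (v + 1) / 2) (by linarith)
    (by positivity : 0 ≤ y / √v) hbc
  have he : 0 ≤ √v / √(v - 2) - 1 := by
    rw [sub_nonneg, le_div_iff₀ hs2]; linarith
  have hgap := inv_le_standardization_gap hv hyv he (by
    rw [add_sub_cancel, div_pow, Real.sq_sqrt hv0.le, Real.sq_sqrt hv2.le]; field_simp)
  set e := √v / √(v - 2) - 1 with hedef
  set b := y / √v with hb
  have hb0 : 0 ≤ b := by positivity
  have hb2 : b ^ 2 = y ^ 2 / v := by rw [hb, div_pow, Real.sq_sqrt hv0.le]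
  have hcb : y / √(v - 2) - b = b * e := by
    rw [hb, hedef]; field_simp
  rw [hcb] at hlow
  have hG : 0 ≤ (1 + b ^ 2) ^ (-((v + 1) / 2)) := by positivity
  have key : b / v ≤ b * e - (v + 1) / 2 * ((b * e) ^ 2 * b + (b * e) ^ 3 / 3) := by
    rw [← hb2] at hgap
    have := mul_le_mul_of_nonneg_left hgap hb0
    calc b / v = b * (1 / v) := by ring
      _ ≤ _ := this
      _ = _ := by ring
  have := mul_le_mul_of_nonneg_left key hG
  have e3 : b * (1 + b ^ 2) ^ (-((v + 1) / 2)) / v = (1 + b ^ 2) ^ (-((v + 1) / 2)) * (b / v) := by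
    ring
  linarith

lemma sInf_eq_sInf_initial_of_le_add_two {p : ℕ → ℝ} {m N : ℕ} (hN : m + 1 ≤ N)
    (h : ∀ n, N < n + 2 → p n ≤ p (n + 2)) :
    sInf {x : ℝ | ∃ n, m ≤ n ∧ x = p n} = sInf {x : ℝ | ∃ n, m ≤ n ∧ n ≤ N ∧ x = p n} := by
  have hex : ∀ n, m ≤ n → ∃ k, m ≤ k ∧ k ≤ N ∧ p k ≤ p n := by
    intro n
    induction n using Nat.strong_induction_on with
    | _ n ih =>
      intro hn
      by_cases hnN : n ≤ N
      · exact ⟨n, hn, hnN, le_rfl⟩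
      · obtain ⟨k, hk⟩ : ∃ k, n = k + 2 := ⟨n - 2, by omega⟩
        obtain ⟨j, hj1, hj2, hj3⟩ := ih k (by omega) (by omega)
        exact ⟨j, hj1, hj2, hj3.trans (hk ▸ h k (by omega))⟩
  have hfin : {x : ℝ | ∃ n, m ≤ n ∧ n ≤ N ∧ x = p n}.Finite := by
    refine ((Set.finite_Icc m N).image p).subset ?_
    rintro x ⟨n, h1, h2, rfl⟩
    exact ⟨n, ⟨h1, h2⟩, rfl⟩
  have hbdd : BddBelow {x : ℝ | ∃ n, m ≤ n ∧ x = p n} := by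
    obtain ⟨c, hc⟩ := hfin.bddBelow
    refine ⟨c, ?_⟩
    rintro x ⟨n, hn, rfl⟩
    obtain ⟨k, h1, h2, h3⟩ := hex n hn
    exact (hc ⟨k, h1, h2, rfl⟩).trans h3
  apply le_antisymm
  · refine csInf_le_csInf hbdd ⟨p m, m, le_rfl, by omega, rfl⟩ ?_
    rintro x ⟨n, h1, -, h2⟩
    exact ⟨n, h1, h2⟩
  · refine le_csInf ⟨p m, m, le_rfl, rfl⟩ ?_
    rintro x ⟨n, hn, rfl⟩
    obtain ⟨k, h1, h2, h3⟩ := hex n hn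
    exact (csInf_le hfin.bddBelow ⟨k, h1, h2, rfl⟩).trans h3

theorem stmt_19 (y C₁ C₂ C₃ V₁ V₂ V₃ v₀ : ℝ)
    (hy1 : 1 < y) (hy2 : y < Real.sqrt 3)
    (hC₁ : C₁ = 2 * y ^ 6 + (3 / 4) * y ^ 4)
    (hC₂ : C₂ = (9 / 4) * C₁ + (25 / 32) * y ^ 8
        + (3 / 2) * (C₁ ^ ((2 : ℝ) / 3) * y ^ ((8 : ℝ) / 3)
          + C₁ ^ ((1 : ℝ) / 3) * y ^ ((16 : ℝ) / 3)))
    (hC₃ : C₃ = (13 / 3) * y ^ 4 + 18 * y ^ 2 + 2 * C₂ + 11)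
    (hV₁ : V₁ = max 100 (8 * y ^ 2))
    (hV₂ : V₂ = max V₁ (max ((3 / 2) * y ^ 4) (Real.sqrt (2 * C₁))))
    (hV₃ : V₃ = max V₂ (max (2 + 2 * y ^ 2 / (1 + 2 * y))
        (2 + 2 * y ^ 4 / (1 + 2 * y ^ 2))))
    (hv₀ : v₀ = max V₃ (2 * C₃ / |y ^ 2 - 3| + 1)) :
    sInf {p : ℝ | ∃ v : ℕ, 3 ≤ v ∧
        p = 2 - 2 * tCDF v (y * Real.sqrt ((v : ℝ) / ((v : ℝ) - 2)))}
      = sInf {p : ℝ | ∃ v : ℕ, 3 ≤ v ∧ v ≤ ⌊v₀⌋₊ + 3 ∧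
        p = 2 - 2 * tCDF v (y * Real.sqrt ((v : ℝ) / ((v : ℝ) - 2)))} := by
  have hysq : y ^ 2 < 3 := by
    have := Real.lt_sqrt (by linarith : (0 : ℝ) ≤ y) |>.1 hy2
    exact this
  have hC₁0 : 0 ≤ C₁ := by rw [hC₁]; positivity
  have hC₂0 : 0 ≤ C₂ := by rw [hC₂]; positivity
  have hC₃9 : 9 ≤ C₃ := by
    have : 0 ≤ (13 / 3) * y ^ 4 + 18 * y ^ 2 := by positivity
    linarith
  have hv100 : 100 ≤ v₀ := by
    rw [hv₀, hV₃, hV₂, hV₁]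
    simp
  have hvC : 18 ≤ v₀ * (3 - y ^ 2) := by
    have h1 : 2 * C₃ / |y ^ 2 - 3| + 1 ≤ v₀ := hv₀ ▸ le_max_right _ _
    rw [abs_sub_comm, abs_of_pos (by linarith)] at h1
    have h2 : 2 * C₃ / (3 - y ^ 2) ≤ v₀ := by linarith
    rw [div_le_iff₀ (by linarith)] at h2
    linarith
  have hfloor : 100 ≤ ⌊v₀⌋₊ := Nat.le_floor (by exact_mod_cast hv100)
  refine sInf_eq_sInf_initial_of_le_add_two
    (p := fun v : ℕ => 2 - 2 * tCDF v (y * Real.sqrt ((v : ℝ) / ((v : ℝ) - 2))))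
    (m := 3) (N := ⌊v₀⌋₊ + 3) (by omega) fun n hn => ?_
  have hn0 : v₀ ≤ n := by
    have h1 := (Nat.lt_floor_add_one v₀).le
    have h2 : ((⌊v₀⌋₊ + 1 : ℕ) : ℝ) ≤ n := by exact_mod_cast (by omega : ⌊v₀⌋₊ + 1 ≤ n)
    push_cast at h2
    linarith
  have hle := tCDF_standardized_add_two_le (v := n) (y := y) (by linarith) (by linarith)
    (hvC.trans (mul_le_mul_of_nonneg_right hn0 (by linarith)))
  simp only [Nat.cast_add, Nat.cast_ofNat, add_sub_cancel_right]
  linarith
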